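/- Let ψ(z) := Γ′(z)/Γ(z) denote the digamma function, the logarithmic derivative of the complex Gamma function Γ. Then for all c₁ > 0 and c₂ > 0 the iterated integral (1/π) ∫₀^∞ t^{−1} ( e^{−tc₁²} − e^{−tc₂²} ) ( ∫_ℝ e^{−tλ²} ψ(1 + iλ) dλ ) dt converges and equals 2 log Γ(1 + c₂) − 2 log Γ(1 + c₁). -/

import Mathlib

open MeasureTheory Real Set

/-- The digamma function `ψ = Γ'/Γ`. -/
noncomputable def digamma (z : ℂ) : ℂ := deriv Complex.Gamma z / Complex.Gamma z

/-- The `n`-th term of the Weierstrass series of `log Γ(1 + z)`. -/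
noncomputable def weierstrassTerm (n : ℕ) (z : ℂ) : ℂ :=
  z / (n + 1) - Complex.log (1 + z / (n + 1))

/-- The `n`-th term of the Mittag-Leffler series of `ψ(1 + z)`. -/
noncomputable def digammaTerm (n : ℕ) (z : ℂ) : ℂ :=
  1 / ((n : ℂ) + 1) - 1 / (n + 1 + z)

lemma one_add_div_re_pos {z : ℂ} (hz : -1 < z.re) (n : ℕ) :
    0 < (1 + z / ((n : ℂ) + 1)).re := by
  have h : (z / ((n : ℂ) + 1)).re = z.re / (n + 1) := by
    rw [show ((n : ℂ) + 1) = ((n + 1 : ℝ) : ℂ) by push_cast; rfl, Complex.div_ofReal_re]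
  rw [Complex.add_re, h, Complex.one_re]
  have hn : (0 : ℝ) < n + 1 := by positivity
  have : -1 < z.re / (n + 1) := by
    rw [lt_div_iff₀ hn]
    have : (0 : ℝ) ≤ n := by positivity
    linarith
  linarith

lemma natCast_add_one_add_ne_zero {z : ℂ} (hz : -1 < z.re) (n : ℕ) : (n : ℂ) + 1 + z ≠ 0 := by
  intro h
  have := congrArg Complex.re h
  simp at this
  have : (0 : ℝ) ≤ n := by positivity
  linarith

lemma hasDerivAt_weierstrassTerm {z : ℂ} (hz : -1 < z.re) (n : ℕ) :
    HasDerivAt (weierstrassTerm n) (digammaTerm n z) z := by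
  have hn : (n : ℂ) + 1 ≠ 0 := by exact_mod_cast n.succ_ne_zero
  have hnz := natCast_add_one_add_ne_zero hz n
  have h1 : HasDerivAt (fun z : ℂ => z / ((n : ℂ) + 1)) (1 / ((n : ℂ) + 1)) z :=
    (hasDerivAt_id z).div_const _
  have h2 := h1.sub ((h1.const_add 1).clog (Or.inl (one_add_div_re_pos hz n)))
  convert! h2 using 1
  have : 1 + z / ((n : ℂ) + 1) = (n + 1 + z) / (n + 1) := by field_simp
  rw [this, digammaTerm]
  field_simp

lemma digammaTerm_eq {z : ℂ} (hz : -1 < z.re) (n : ℕ) :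
    digammaTerm n z = z / ((n + 1) * (n + 1 + z)) := by
  have hn : (n : ℂ) + 1 ≠ 0 := by exact_mod_cast n.succ_ne_zero
  have hnz := natCast_add_one_add_ne_zero hz n
  rw [digammaTerm]
  field_simp
  ring

lemma norm_digammaTerm_le {z : ℂ} {R : ℝ} (hz : -(1 / 2) < z.re) (hR : ‖z‖ < R) (n : ℕ) :
    ‖digammaTerm n z‖ ≤ 2 * R * (1 / ((n + 1 : ℕ) : ℝ) ^ 2) := by
  rw [digammaTerm_eq (by linarith), norm_div, norm_mul]
  have e : ‖(n : ℂ) + 1‖ = n + 1 := by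
    exact_mod_cast Complex.norm_natCast (n + 1)
  have hn : (0 : ℝ) < n + 1 := by positivity
  have h0 : (0 : ℝ) ≤ n := by positivity
  have h : ((n : ℝ) + 1) / 2 ≤ ‖(n : ℂ) + 1 + z‖ := by
    refine le_trans ?_ (Complex.re_le_norm _)
    simp
    linarith
  rw [e, show 2 * R * (1 / ((n + 1 : ℕ) : ℝ) ^ 2) = R / ((n + 1) * ((n + 1) / 2)) by
    push_cast; field_simp]
  have hR0 : 0 ≤ R := (norm_nonneg z).trans hR.le
  gcongr

lemma summable_weierstrassTerm_and_hasDerivAt_tsum {z : ℂ} (hz : -(1 / 2) < z.re) :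
    Summable (fun n => weierstrassTerm n z) ∧
    HasDerivAt (fun z => ∑' n, weierstrassTerm n z) (∑' n, digammaTerm n z) z := by
  set R := ‖z‖ + 1
  have hR : 0 < R := by positivity
  set t : Set ℂ := {z | -(1 / 2) < z.re} ∩ Metric.ball 0 R
  have ht : IsOpen t := (isOpen_lt continuous_const Complex.continuous_re).inter Metric.isOpen_ball
  have htc : IsPreconnected t :=
    ((convex_halfSpace_re_gt _).inter (convex_ball 0 R)).isPreconnected
  have hu : Summable (fun n : ℕ => 2 * R * (1 / ((n + 1 : ℕ) : ℝ) ^ 2)) :=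
    (((summable_nat_add_iff 1).mpr (Real.summable_one_div_nat_pow.mpr one_lt_two))).mul_left _
  have hd : ∀ n y, y ∈ t → HasDerivAt (weierstrassTerm n) (digammaTerm n y) y :=
    fun n y hy => hasDerivAt_weierstrassTerm (by have := hy.1; simp at this; linarith) n
  have hb : ∀ n y, y ∈ t → ‖digammaTerm n y‖ ≤ 2 * R * (1 / ((n + 1 : ℕ) : ℝ) ^ 2) :=
    fun n y hy => norm_digammaTerm_le hy.1 (by simpa using hy.2) n
  have h0 : (0 : ℂ) ∈ t := ⟨by simp, by simpa using hR⟩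
  have hs : Summable fun n => weierstrassTerm n 0 := by simp [weierstrassTerm, summable_zero]
  have hzt : z ∈ t := ⟨hz, by simp [R]⟩
  exact ⟨summable_of_summable_hasDerivAt_of_isPreconnected hu ht htc hd hb h0 hs hzt,
    hasDerivAt_tsum_of_isPreconnected hu ht htc hd hb h0 hs hzt⟩

lemma exp_sum_weierstrassTerm {z : ℂ} (hz : -1 < z.re) (n : ℕ) :
    Complex.exp (∑ k ∈ Finset.range n, weierstrassTerm k z) =
      Complex.exp (z * (harmonic n : ℝ)) * n.factorial /
        ∏ k ∈ Finset.range n, ((k : ℂ) + 1 + z) := by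
  induction n with
  | zero => simp
  | succ n ih =>
    have hn : (n : ℂ) + 1 ≠ 0 := by exact_mod_cast n.succ_ne_zero
    have hnz := natCast_add_one_add_ne_zero hz n
    have hp : 1 + z / ((n : ℂ) + 1) ≠ 0 := by
      intro h
      have := one_add_div_re_pos hz n
      simp [h] at this
    have hP : ∏ k ∈ Finset.range n, ((k : ℂ) + 1 + z) ≠ 0 :=
      Finset.prod_ne_zero_iff.mpr fun k _ => natCast_add_one_add_ne_zero hz k
    rw [Finset.sum_range_succ, Complex.exp_add, ih, weierstrassTerm, Complex.exp_sub,
      Complex.exp_log hp, harmonic_succ, Finset.prod_range_succ, Nat.factorial_succ]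
    have e1 : z * (((harmonic n + ((n + 1 : ℕ) : ℚ)⁻¹ : ℚ) : ℝ) : ℂ) =
        z * ((harmonic n : ℝ) : ℂ) + z / (n + 1) := by
      push_cast; ring
    rw [e1, Complex.exp_add]
    have e2 : 1 + z / ((n : ℂ) + 1) = (n + 1 + z) / (n + 1) := by field_simp
    rw [e2]
    push_cast
    field_simp

lemma mul_GammaSeq_eq {z : ℂ} (hz : -1 < z.re) (hz0 : z ≠ 0) {n : ℕ} (hn : n ≠ 0) :
    z * Complex.GammaSeq z n =
      Complex.exp (-z * ((harmonic n - Real.log n : ℝ) : ℂ)) *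
        Complex.exp (∑ k ∈ Finset.range n, weierstrassTerm k z) := by
  have hP : ∏ k ∈ Finset.range n, ((k : ℂ) + 1 + z) ≠ 0 :=
    Finset.prod_ne_zero_iff.mpr fun k _ => natCast_add_one_add_ne_zero hz k
  have hn' : (n : ℂ) ≠ 0 := by exact_mod_cast hn
  rw [exp_sum_weierstrassTerm hz, Complex.GammaSeq, Finset.prod_range_succ',
    Complex.cpow_def_of_ne_zero hn']
  have e1 : -z * ((harmonic n - Real.log n : ℝ) : ℂ) + z * ((harmonic n : ℝ) : ℂ) =
      Complex.log n * z := by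
    push_cast
    ring
  have e2 : ∏ k ∈ Finset.range n, (z + ((k + 1 : ℕ) : ℂ)) =
      ∏ k ∈ Finset.range n, ((k : ℂ) + 1 + z) :=
    Finset.prod_congr rfl fun k _ => by push_cast; ring
  rw [← e1, e2, Complex.exp_add]
  push_cast
  rw [add_zero]
  field_simp

/-- The Weierstrass product for the Gamma function. -/
lemma Gamma_one_add_eq_exp_tsum {z : ℂ} (hz : -(1 / 2) < z.re) :
    Complex.Gamma (1 + z) =
      Complex.exp (-z * Real.eulerMascheroniConstant + ∑' n, weierstrassTerm n z) := by
  rcases eq_or_ne z 0 with rfl | hz0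
  · simp [weierstrassTerm]
  have h1 : Filter.Tendsto (fun n => z * Complex.GammaSeq z n) Filter.atTop
      (nhds (Complex.Gamma (1 + z))) := by
    rw [add_comm, Complex.Gamma_add_one z hz0]
    exact (Complex.GammaSeq_tendsto_Gamma z).const_mul z
  refine tendsto_nhds_unique h1 ?_
  rw [Complex.exp_add]
  have h2 : Filter.Tendsto (fun n : ℕ => Complex.exp (-z * ((harmonic n - Real.log n : ℝ) : ℂ)) *
        Complex.exp (∑ k ∈ Finset.range n, weierstrassTerm k z)) Filter.atTop
      (nhds (Complex.exp (-z * Real.eulerMascheroniConstant) *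
        Complex.exp (∑' n, weierstrassTerm n z))) := by
    refine Filter.Tendsto.mul ?_ ?_
    · refine (Complex.continuous_exp.tendsto _).comp (Filter.Tendsto.const_mul _ ?_)
      exact (Complex.continuous_ofReal.tendsto _).comp Real.tendsto_harmonic_sub_log
    · exact (Complex.continuous_exp.tendsto _).comp
        (summable_weierstrassTerm_and_hasDerivAt_tsum hz).1.hasSum.tendsto_sum_nat
  refine h2.congr' ?_
  filter_upwards [Filter.eventually_ne_atTop 0] with n hn
  exact (mul_GammaSeq_eq (by linarith) hz0 hn).symm

/-- The Mittag-Leffler expansion of the digamma function. -/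
lemma digamma_one_add_eq_tsum {z : ℂ} (hz : -(1 / 2) < z.re) :
    digamma (1 + z) = -Real.eulerMascheroniConstant + ∑' n, digammaTerm n z := by
  have hS := (summable_weierstrassTerm_and_hasDerivAt_tsum hz).2
  have h1 : HasDerivAt (fun z : ℂ => -z * Real.eulerMascheroniConstant)
      (-Real.eulerMascheroniConstant : ℂ) z := by
    simpa using (hasDerivAt_id z).neg.mul_const (Real.eulerMascheroniConstant : ℂ)
  have h2 := (h1.add hS).cexp
  have h3 : (fun z => Complex.Gamma (1 + z)) =ᶠ[nhds z]
      fun z => Complex.exp (-z * Real.eulerMascheroniConstant + ∑' n, weierstrassTerm n z) := by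
    filter_upwards [(isOpen_lt continuous_const Complex.continuous_re).mem_nhds hz] with w hw
    exact Gamma_one_add_eq_exp_tsum hw
  have h4 := (h2.congr_of_eventuallyEq h3).deriv
  rw [deriv_comp_const_add] at h4
  rw [digamma, h4, Gamma_one_add_eq_exp_tsum hz]
  exact mul_div_cancel_left₀ _ (Complex.exp_ne_zero _)

lemma differentiableOn_digamma : DifferentiableOn ℂ digamma {z | 0 < z.re} := by
  have hΓ : DifferentiableOn ℂ Complex.Gamma {z | 0 < z.re} := fun z hz =>
    (Complex.differentiableAt_Gamma z fun m h => by
      have : (0 : ℝ) < z.re := hz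
      rw [h] at this
      simp at this
      linarith [(Nat.cast_nonneg m : (0 : ℝ) ≤ m)]).differentiableWithinAt
  exact (hΓ.deriv (isOpen_lt continuous_const Complex.continuous_re)).div hΓ
    fun z hz => Complex.Gamma_ne_zero_of_re_pos hz

lemma continuous_digamma_one_add_I_mul : Continuous fun l : ℝ => digamma (1 + Complex.I * l) :=
  differentiableOn_digamma.continuousOn.comp_continuous (by fun_prop) (by simp)

lemma norm_digammaTerm_I_mul_le (n : ℕ) (l : ℝ) :
    ‖digammaTerm n (Complex.I * l)‖ ≤
      (1 + l ^ 2) ^ (1 / 4 : ℝ) * (1 / ((n + 1 : ℕ) : ℝ) ^ (3 / 2 : ℝ)) := by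
  have hN : (0 : ℝ) < ((n + 1 : ℕ) : ℝ) := by positivity
  set N : ℝ := ((n + 1 : ℕ) : ℝ) with hNdef
  rw [digammaTerm_eq (by simp), norm_div, norm_mul, norm_mul, Complex.norm_I, one_mul,
    Complex.norm_real, Real.norm_eq_abs]
  have e1 : ‖(n : ℂ) + 1‖ = N := by
    rw [hNdef]
    exact_mod_cast Complex.norm_natCast (n + 1)
  have e2 : ‖(n : ℂ) + 1 + Complex.I * l‖ = √(N ^ 2 + l ^ 2) := by
    rw [show (n : ℂ) + 1 + Complex.I * l = (N : ℂ) + (l : ℂ) * Complex.I by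
      rw [hNdef]; push_cast; ring, Complex.norm_add_mul_I]
  have h1 : |l| ^ (1 / 2 : ℝ) ≤ (1 + l ^ 2) ^ (1 / 4 : ℝ) := by
    rw [show (1 / 2 : ℝ) = 2 * (1 / 4) by norm_num, Real.rpow_mul (abs_nonneg l)]
    refine Real.rpow_le_rpow (by positivity) ?_ (by norm_num)
    rw [Real.rpow_two, sq_abs]
    linarith
  have h2 : N ^ (1 / 2 : ℝ) * |l| ^ (1 / 2 : ℝ) ≤ √(N ^ 2 + l ^ 2) := by
    rw [← Real.mul_rpow hN.le (abs_nonneg l), ← Real.sqrt_eq_rpow]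
    refine Real.sqrt_le_sqrt ?_
    nlinarith [sq_nonneg (N - |l|), sq_abs l, mul_nonneg hN.le (abs_nonneg l)]
  have h3 : |l| ^ (1 / 2 : ℝ) * |l| ^ (1 / 2 : ℝ) = |l| := by
    rw [← Real.sqrt_eq_rpow, Real.mul_self_sqrt (abs_nonneg l)]
  have h4 : N ^ (3 / 2 : ℝ) = N * N ^ (1 / 2 : ℝ) := by
    rw [show (3 / 2 : ℝ) = 1 + 1 / 2 by norm_num, Real.rpow_add hN, Real.rpow_one]
  have hS : 0 < √(N ^ 2 + l ^ 2) := by positivity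
  rw [e1, e2, h4, mul_one_div, div_le_div_iff₀ (by positivity) (by positivity)]
  calc |l| * (N * N ^ (1 / 2 : ℝ))
      = |l| ^ (1 / 2 : ℝ) * (N * (N ^ (1 / 2 : ℝ) * |l| ^ (1 / 2 : ℝ))) := by
        nth_rewrite 1 [← h3]; ring
    _ ≤ (1 + l ^ 2) ^ (1 / 4 : ℝ) * (N * √(N ^ 2 + l ^ 2)) := by gcongr

lemma summable_one_div_nat_add_one_rpow_three_halves :
    Summable fun n : ℕ => 1 / ((n + 1 : ℕ) : ℝ) ^ (3 / 2 : ℝ) :=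
  (summable_nat_add_iff 1).mpr (Real.summable_one_div_nat_rpow.mpr (by norm_num))

lemma exists_norm_digamma_one_add_I_mul_le :
    ∃ C : ℝ, ∀ l : ℝ, ‖digamma (1 + Complex.I * l)‖ ≤ C * (1 + l ^ 2) ^ (1 / 4 : ℝ) := by
  refine ⟨|Real.eulerMascheroniConstant| + ∑' n : ℕ, 1 / ((n + 1 : ℕ) : ℝ) ^ (3 / 2 : ℝ),
    fun l => ?_⟩
  rw [digamma_one_add_eq_tsum (by simp), add_mul]
  refine (norm_add_le _ _).trans (add_le_add ?_ ?_)
  · rw [norm_neg, Complex.norm_real, Real.norm_eq_abs]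
    refine le_mul_of_one_le_right (abs_nonneg _) (Real.one_le_rpow ?_ (by norm_num))
    nlinarith [sq_nonneg l]
  · rw [mul_comm (∑' n : ℕ, _)]
    exact tsum_of_norm_bounded
      (summable_one_div_nat_add_one_rpow_three_halves.hasSum.mul_left _)
      fun n => norm_digammaTerm_I_mul_le n l

lemma inv_sq_add_sq_le {c : ℝ} (hc : 0 < c) (l : ℝ) :
    (c ^ 2 + l ^ 2)⁻¹ ≤ (1 + (c ^ 2)⁻¹) * (1 + l ^ 2)⁻¹ := by
  have h : 1 + l ^ 2 ≤ (1 + (c ^ 2)⁻¹) * (c ^ 2 + l ^ 2) := by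
    have : (1 + (c ^ 2)⁻¹) * (c ^ 2 + l ^ 2) = 1 + l ^ 2 + (c ^ 2 + (c ^ 2)⁻¹ * l ^ 2) := by
      field_simp
      ring
    rw [this]
    have : 0 ≤ c ^ 2 + (c ^ 2)⁻¹ * l ^ 2 := by positivity
    linarith
  rw [← div_eq_mul_inv, ← one_div, div_le_div_iff₀ (by positivity) (by positivity)]
  linarith

lemma integrable_inv_sq_add_sq {c : ℝ} (hc : 0 < c) :
    Integrable fun l : ℝ => (c ^ 2 + l ^ 2)⁻¹ := by
  refine (integrable_inv_one_add_sq.const_mul (1 + (c ^ 2)⁻¹)).mono'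
    (Measurable.aestronglyMeasurable (by fun_prop)) (.of_forall fun l => ?_)
  rw [Real.norm_of_nonneg (by positivity)]
  exact inv_sq_add_sq_le hc l

lemma integrable_inv_sq_add_sq_mul_rpow {c : ℝ} (hc : 0 < c) :
    Integrable fun l : ℝ => (c ^ 2 + l ^ 2)⁻¹ * (1 + l ^ 2) ^ (1 / 4 : ℝ) := by
  have h : Integrable fun l : ℝ => (1 + ‖l‖ ^ 2) ^ (-(3 / 2 : ℝ) / 2) :=
    integrable_rpow_neg_one_add_norm_sq (by norm_num)
  refine (h.const_mul (1 + (c ^ 2)⁻¹)).mono'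
    (Measurable.aestronglyMeasurable (by fun_prop)) (.of_forall fun l => ?_)
  rw [Real.norm_of_nonneg (by positivity), Real.norm_eq_abs, sq_abs]
  have e : (1 + l ^ 2) ^ (-(3 / 2 : ℝ) / 2) = (1 + l ^ 2)⁻¹ * (1 + l ^ 2) ^ (1 / 4 : ℝ) := by
    rw [← Real.rpow_neg_one, ← Real.rpow_add (by positivity)]
    norm_num
  rw [e, ← mul_assoc]
  gcongr
  exact inv_sq_add_sq_le hc l

lemma integrable_inv_sq_add_sq_mul_norm_digamma {c : ℝ} (hc : 0 < c) :
    Integrable fun l : ℝ => (c ^ 2 + l ^ 2)⁻¹ * ‖digamma (1 + Complex.I * l)‖ := by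
  obtain ⟨C, hC⟩ := exists_norm_digamma_one_add_I_mul_le
  refine ((integrable_inv_sq_add_sq_mul_rpow hc).const_mul C).mono' ?_ (.of_forall fun l => ?_)
  · exact (integrable_inv_sq_add_sq hc).aestronglyMeasurable.mul
      continuous_digamma_one_add_I_mul.norm.aestronglyMeasurable
  · rw [Real.norm_of_nonneg (by positivity), mul_left_comm]
    gcongr
    exact hC l

lemma integral_univ_inv_sq_add_sq {c : ℝ} (hc : 0 < c) :
    ∫ l : ℝ, (c ^ 2 + l ^ 2)⁻¹ = π / c := by
  have h := Measure.integral_comp_inv_mul_left (fun x : ℝ => (1 + x ^ 2)⁻¹) c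
  rw [integral_univ_inv_one_add_sq, abs_of_pos hc, smul_eq_mul] at h
  have e : ∀ l : ℝ, (c ^ 2 + l ^ 2)⁻¹ = (c ^ 2)⁻¹ * (1 + (c⁻¹ * l) ^ 2)⁻¹ := fun l => by
    rw [← mul_inv]
    congr 1
    field_simp
  simp_rw [e]
  rw [integral_const_mul, h]
  field_simp

lemma integral_inv_sq_add_sq_mul_div {c m : ℝ} (hc : 0 < c) (hm : 0 < m) (hcm : c ≠ m) :
    ∫ l : ℝ, (c ^ 2 + l ^ 2)⁻¹ * (m / (m ^ 2 + l ^ 2)) = π / (c * (m + c)) := by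
  have hd : m ^ 2 - c ^ 2 ≠ 0 := by
    rw [sq_sub_sq]
    exact mul_ne_zero (by positivity) (sub_ne_zero.mpr hcm.symm)
  have hd' : m - c ≠ 0 := sub_ne_zero.mpr hcm.symm
  have e : ∀ l : ℝ, (c ^ 2 + l ^ 2)⁻¹ * (m / (m ^ 2 + l ^ 2)) =
      m / (m ^ 2 - c ^ 2) * ((c ^ 2 + l ^ 2)⁻¹ - (m ^ 2 + l ^ 2)⁻¹) := fun l => by
    have h1 : c ^ 2 + l ^ 2 ≠ 0 := by positivity
    have h2 : m ^ 2 + l ^ 2 ≠ 0 := by positivity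
    field_simp
    ring
  simp_rw [e]
  rw [integral_const_mul, integral_sub (integrable_inv_sq_add_sq hc) (integrable_inv_sq_add_sq hm),
    integral_univ_inv_sq_add_sq hc, integral_univ_inv_sq_add_sq hm, sq_sub_sq]
  have : m + c ≠ 0 := by positivity
  field_simp

lemma integral_eq_zero_of_forall_neg_eq_neg {f : ℝ → ℝ} (hf : ∀ x, f (-x) = -f x) :
    ∫ x, f x = 0 := by
  have h := integral_neg_eq_self f volume
  simp_rw [hf, integral_neg] at h
  linarith

/-- The Poisson integral of `1 / (m + z)` over the imaginary axis. -/
lemma integral_inv_sq_add_sq_mul_one_div {c m : ℝ} (hc : 0 < c) (hm : 0 < m) (hcm : c ≠ m) :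
    ∫ l : ℝ, (((c ^ 2 + l ^ 2)⁻¹ : ℝ) : ℂ) * (1 / (m + Complex.I * l)) =
      ((π / c : ℝ) : ℂ) * (1 / (m + c)) := by
  have e : ∀ l : ℝ, (((c ^ 2 + l ^ 2)⁻¹ : ℝ) : ℂ) * (1 / (m + Complex.I * l)) =
      (((c ^ 2 + l ^ 2)⁻¹ * (m / (m ^ 2 + l ^ 2)) : ℝ) : ℂ) -
        (((c ^ 2 + l ^ 2)⁻¹ * (l / (m ^ 2 + l ^ 2)) : ℝ) : ℂ) * Complex.I := fun l => by
    have h1 : (m : ℂ) + Complex.I * l ≠ 0 := by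
      intro h
      have := congrArg Complex.re h
      simp at this
      exact hm.ne' this
    have h2 : (m : ℂ) ^ 2 + l ^ 2 ≠ 0 := by
      have : m ^ 2 + l ^ 2 ≠ 0 := by positivity
      exact_mod_cast this
    have h3 : 1 / ((m : ℂ) + Complex.I * l) = m / (m ^ 2 + l ^ 2) -
        l / (m ^ 2 + l ^ 2) * Complex.I := by
      field_simp
      linear_combination (l : ℂ) ^ 2 * Complex.I_sq
    rw [h3]
    push_cast
    ring
  have hb : ∀ g : ℝ → ℝ, Measurable g → (∀ l, |g l| ≤ m + |l|) →
      Integrable fun l => (c ^ 2 + l ^ 2)⁻¹ * (g l / (m ^ 2 + l ^ 2)) := fun g hg hgb => by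
    refine ((integrable_inv_sq_add_sq hc).mul_const (2 / m)).mono'
      (Measurable.aestronglyMeasurable (by fun_prop)) (.of_forall fun l => ?_)
    rw [norm_mul, Real.norm_of_nonneg (by positivity), norm_div, Real.norm_eq_abs,
      Real.norm_of_nonneg (by positivity : 0 ≤ m ^ 2 + l ^ 2)]
    refine mul_le_mul_of_nonneg_left ?_ (by positivity)
    rw [div_le_div_iff₀ (by positivity) hm]
    nlinarith [hgb l, sq_abs l, sq_nonneg (m - |l|), abs_nonneg l,
      mul_le_mul_of_nonneg_right (hgb l) hm.le]
  have i1 := hb (fun _ => m) measurable_const fun l => by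
    rw [abs_of_pos hm]; linarith [abs_nonneg l]
  have i2 := hb (fun l => l) measurable_id fun l => by linarith
  simp_rw [e]
  rw [integral_sub i1.ofReal (i2.ofReal.mul_const _), integral_mul_const, integral_complex_ofReal,
    integral_complex_ofReal, integral_inv_sq_add_sq_mul_div hc hm hcm,
    integral_eq_zero_of_forall_neg_eq_neg (f := fun l => (c ^ 2 + l ^ 2)⁻¹ * (l / (m ^ 2 + l ^ 2)))]
  · push_cast
    rw [div_mul_div_comm]
    ring
  · intro x
    rw [neg_sq]
    ring

lemma continuous_digammaTerm_I_mul (n : ℕ) :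
    Continuous fun l : ℝ => digammaTerm n (Complex.I * l) := by
  unfold digammaTerm
  refine continuous_const.sub (continuous_const.div (by fun_prop) fun l => ?_)
  exact natCast_add_one_add_ne_zero (by simp) n

lemma norm_inv_sq_add_sq_mul_digammaTerm_le (c : ℝ) (n : ℕ) (l : ℝ) :
    ‖(((c ^ 2 + l ^ 2)⁻¹ : ℝ) : ℂ) * digammaTerm n (Complex.I * l)‖ ≤
      (c ^ 2 + l ^ 2)⁻¹ * (1 + l ^ 2) ^ (1 / 4 : ℝ) * (1 / ((n + 1 : ℕ) : ℝ) ^ (3 / 2 : ℝ)) := by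
  rw [norm_mul, Complex.norm_real, Real.norm_of_nonneg (by positivity), mul_assoc]
  gcongr
  exact norm_digammaTerm_I_mul_le n l

lemma integrable_inv_sq_add_sq_mul_digammaTerm {c : ℝ} (hc : 0 < c) (n : ℕ) :
    Integrable fun l : ℝ => (((c ^ 2 + l ^ 2)⁻¹ : ℝ) : ℂ) * digammaTerm n (Complex.I * l) :=
  ((integrable_inv_sq_add_sq_mul_rpow hc).mul_const _).mono'
    ((integrable_inv_sq_add_sq hc).ofReal.aestronglyMeasurable.mul
      (continuous_digammaTerm_I_mul n).aestronglyMeasurable)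
    (.of_forall fun l => norm_inv_sq_add_sq_mul_digammaTerm_le c n l)

lemma integral_inv_sq_add_sq_mul_digammaTerm {c : ℝ} (hc : 0 < c) {n : ℕ} (hcn : c ≠ n + 1) :
    ∫ l : ℝ, (((c ^ 2 + l ^ 2)⁻¹ : ℝ) : ℂ) * digammaTerm n (Complex.I * l) =
      ((π / c : ℝ) : ℂ) * digammaTerm n c := by
  have hI : Integrable fun l : ℝ => (((c ^ 2 + l ^ 2)⁻¹ : ℝ) : ℂ) :=
    (integrable_inv_sq_add_sq hc).ofReal
  have h1 := hI.mul_const (1 / ((n : ℂ) + 1))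
  have h2 : Integrable fun l : ℝ => (((c ^ 2 + l ^ 2)⁻¹ : ℝ) : ℂ) *
      (1 / ((n : ℂ) + 1 + Complex.I * l)) := by
    refine (h1.sub (integrable_inv_sq_add_sq_mul_digammaTerm hc n)).congr (.of_forall fun l => ?_)
    simp only [digammaTerm, Pi.sub_apply]
    ring
  have h3 := integral_inv_sq_add_sq_mul_one_div hc (m := n + 1) (by positivity) hcn
  push_cast at h3
  simp only [digammaTerm, mul_sub]
  rw [integral_sub h1 h2, integral_mul_const, integral_complex_ofReal,
    integral_univ_inv_sq_add_sq hc]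
  push_cast
  rw [h3]

/-- The Poisson integral formula for `ψ(1 + z)` in the right half-plane. -/
lemma integral_inv_sq_add_sq_mul_digamma {c : ℝ} (hc : 0 < c) (hcn : ∀ n : ℕ, c ≠ n + 1) :
    ∫ l : ℝ, (((c ^ 2 + l ^ 2)⁻¹ : ℝ) : ℂ) * digamma (1 + Complex.I * l) =
      ((π / c : ℝ) : ℂ) * digamma (1 + c) := by
  have hs := hasSum_integral_of_summable_integral_norm
    (integrable_inv_sq_add_sq_mul_digammaTerm hc) (by
      refine Summable.of_nonneg_of_le (fun n => integral_nonneg fun l => norm_nonneg _)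
        (fun n => integral_mono (integrable_inv_sq_add_sq_mul_digammaTerm hc n).norm
          ((integrable_inv_sq_add_sq_mul_rpow hc).mul_const _)
          fun l => norm_inv_sq_add_sq_mul_digammaTerm_le c n l) ?_
      simp_rw [integral_mul_const]
      exact summable_one_div_nat_add_one_rpow_three_halves.mul_left _)
  simp_rw [integral_inv_sq_add_sq_mul_digammaTerm hc (hcn _), tsum_mul_left] at hs
  have hI : Integrable fun l : ℝ => (((c ^ 2 + l ^ 2)⁻¹ : ℝ) : ℂ) :=
    (integrable_inv_sq_add_sq hc).ofReal
  have hψ : Integrable fun l : ℝ => (((c ^ 2 + l ^ 2)⁻¹ : ℝ) : ℂ) * digamma (1 + Complex.I * l) := by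
    refine (integrable_inv_sq_add_sq_mul_norm_digamma hc).mono'
      (hI.aestronglyMeasurable.mul
        continuous_digamma_one_add_I_mul.aestronglyMeasurable) (.of_forall fun l => ?_)
    rw [norm_mul, Complex.norm_real, Real.norm_of_nonneg (by positivity)]
  have e : ∀ l : ℝ, (((c ^ 2 + l ^ 2)⁻¹ : ℝ) : ℂ) * ∑' n, digammaTerm n (Complex.I * l) =
      (((c ^ 2 + l ^ 2)⁻¹ : ℝ) : ℂ) * digamma (1 + Complex.I * l) +
        (((c ^ 2 + l ^ 2)⁻¹ : ℝ) : ℂ) * Real.eulerMascheroniConstant := fun l => by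
    rw [digamma_one_add_eq_tsum (by simp)]
    ring
  simp_rw [e] at hs
  rw [integral_add hψ (hI.mul_const _), integral_mul_const, integral_complex_ofReal,
    integral_univ_inv_sq_add_sq hc] at hs
  have ht := hs.tsum_eq
  rw [tsum_mul_left] at ht
  rw [digamma_one_add_eq_tsum (by simp; linarith)]
  linear_combination -ht

lemma intervalIntegral_two_mul_mul_exp {t : ℝ} (ht : t ≠ 0) (a b : ℝ) :
    ∫ c in a..b, 2 * c * Real.exp (-t * c ^ 2) =
      t⁻¹ * (Real.exp (-t * a ^ 2) - Real.exp (-t * b ^ 2)) := by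
  have h : ∀ c ∈ uIcc a b, HasDerivAt (fun c : ℝ => -t⁻¹ * Real.exp (-t * c ^ 2))
      (2 * c * Real.exp (-t * c ^ 2)) c := fun c _ => by
    have := ((((hasDerivAt_pow 2 c).const_mul (-t)).exp).const_mul (-t⁻¹))
    refine this.congr_deriv ?_
    push_cast
    linear_combination (2 * c * Real.exp (-t * c ^ 2)) * inv_mul_cancel₀ ht
  rw [intervalIntegral.integral_eq_sub_of_hasDerivAt h
    (Continuous.intervalIntegrable (by fun_prop) _ _)]
  ring

lemma intervalIntegral_digamma_one_add {a b : ℝ} (ha : 0 < a) (hb : 0 < b) :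
    ∫ c in a..b, digamma (1 + c) =
      (Real.log (Real.Gamma (1 + b)) : ℂ) - (Real.log (Real.Gamma (1 + a)) : ℂ) := by
  have hpos : ∀ c ∈ uIcc a b, 0 < 1 + c := fun c hc => by
    have : min a b ≤ c := hc.1
    have : 0 < min a b := lt_min ha hb
    linarith
  have h : ∀ c ∈ uIcc a b, HasDerivAt (fun c : ℝ => (Real.log (Real.Gamma (1 + c)) : ℂ))
      (digamma (1 + c)) c := fun c hc => by
    have hc := hpos c hc
    have hΓ : DifferentiableAt ℂ Complex.Gamma (1 + c) :=
      Complex.differentiableAt_Gamma _ fun m h => by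
        have := congrArg Complex.re h
        simp at this
        linarith [(Nat.cast_nonneg m : (0 : ℝ) ≤ m)]
    have e : ∀ x : ℝ, Complex.Gamma (1 + x) = (Real.Gamma (1 + x) : ℂ) := fun x => by
      rw [← Complex.Gamma_ofReal]
      push_cast
      rfl
    have h1 : HasDerivAt (fun x : ℝ => Complex.Gamma (1 + x)) (deriv Complex.Gamma (1 + c)) c :=
      (hΓ.hasDerivAt.comp_const_add 1 (c : ℂ)).comp_ofReal
    have h2 := h1.clog_real (by
      rw [e]
      exact Complex.ofReal_mem_slitPlane.mpr (Real.Gamma_pos_of_pos hc))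
    refine h2.congr_of_eventuallyEq ?_
    filter_upwards [lt_mem_nhds (neg_lt_iff_pos_add'.mpr hc)] with x hx
    replace hx : 0 < 1 + x := neg_lt_iff_pos_add'.mp hx
    rw [e, Complex.ofReal_log (Real.Gamma_pos_of_pos hx).le]
  refine intervalIntegral.integral_eq_sub_of_hasDerivAt h (ContinuousOn.intervalIntegrable ?_)
  exact differentiableOn_digamma.continuousOn.comp (by fun_prop) fun c hc => by
    simpa using hpos c hc

/-- The integrand of the triple integral over `(t, (c, λ))`. -/
noncomputable def heatKernelDigamma (p : ℝ × ℝ × ℝ) : ℂ :=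
  ((2 * p.2.1 * Real.exp (-p.1 * p.2.1 ^ 2) : ℝ) : ℂ) *
    ((Real.exp (-p.1 * p.2.2 ^ 2) : ℂ) * digamma (1 + Complex.I * p.2.2))

lemma heatKernelDigamma_eq (t c l : ℝ) :
    heatKernelDigamma (t, c, l) = (Real.exp (-(c ^ 2 + l ^ 2) * t) : ℂ) *
      (((2 * c : ℝ) : ℂ) * digamma (1 + Complex.I * l)) := by
  have : Real.exp (-(c ^ 2 + l ^ 2) * t) = Real.exp (-t * c ^ 2) * Real.exp (-t * l ^ 2) := by
    rw [← Real.exp_add]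
    ring_nf
  rw [heatKernelDigamma, this]
  push_cast
  ring

lemma continuous_heatKernelDigamma : Continuous heatKernelDigamma := by
  have := continuous_digamma_one_add_I_mul.comp
    (continuous_snd.comp (continuous_snd (X := ℝ) (Y := ℝ × ℝ)))
  unfold heatKernelDigamma
  exact (by fun_prop : Continuous fun p : ℝ × ℝ × ℝ =>
    ((2 * p.2.1 * Real.exp (-p.1 * p.2.1 ^ 2) : ℝ) : ℂ)).mul
    ((by fun_prop : Continuous fun p : ℝ × ℝ × ℝ => (Real.exp (-p.1 * p.2.2 ^ 2) : ℂ)).mul this)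

lemma integral_exp_neg_mul_Ioi_zero {a : ℝ} (ha : 0 < a) :
    ∫ t in Ioi (0 : ℝ), Real.exp (-a * t) = a⁻¹ := by
  rw [integral_exp_mul_Ioi (neg_lt_zero.mpr ha)]
  simp

lemma integral_heatKernelDigamma {c : ℝ} (hc : 0 < c) (l : ℝ) :
    ∫ t in Ioi (0 : ℝ), heatKernelDigamma (t, c, l) =
      ((2 * c : ℝ) : ℂ) * ((((c ^ 2 + l ^ 2)⁻¹ : ℝ) : ℂ) * digamma (1 + Complex.I * l)) := by
  simp_rw [heatKernelDigamma_eq]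
  rw [integral_mul_const, integral_complex_ofReal,
    integral_exp_neg_mul_Ioi_zero (by positivity)]
  ring

lemma ae_restrict_Ioc_prod_fst_mem (a b : ℝ) :
    ∀ᵐ y ∂(volume.restrict (Ioc a b)).prod (volume : Measure ℝ), y.1 ∈ Ioc a b :=
  Measure.quasiMeasurePreserving_fst.ae (ae_restrict_mem measurableSet_Ioc)

lemma integrable_heatKernelDigamma {a : ℝ} (ha : 0 < a) (b : ℝ) :
    Integrable heatKernelDigamma
      ((volume.restrict (Ioi 0)).prod ((volume.restrict (Ioc a b)).prod volume)) := by
  rw [integrable_prod_iff' continuous_heatKernelDigamma.aestronglyMeasurable]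
  constructor
  · filter_upwards [ae_restrict_Ioc_prod_fst_mem a b] with ⟨c, l⟩ hc
    have hc0 : 0 < c := ha.trans hc.1
    simp_rw [heatKernelDigamma_eq]
    exact (integrableOn_exp_mul_Ioi (by nlinarith [sq_nonneg l] : -(c ^ 2 + l ^ 2) < 0)
      0).ofReal.mul_const _
  · have h1 : Integrable (fun c : ℝ => 2 * c) (volume.restrict (Ioc a b)) :=
      (Continuous.integrableOn_Icc (by fun_prop)).mono_set Ioc_subset_Icc_self
    refine (h1.mul_prod (integrable_inv_sq_add_sq_mul_norm_digamma ha)).mono'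
      continuous_heatKernelDigamma.aestronglyMeasurable.norm.prod_swap.integral_prod_right' ?_
    filter_upwards [ae_restrict_Ioc_prod_fst_mem a b] with ⟨c, l⟩ hc
    have hc0 : 0 < c := ha.trans hc.1
    rw [Real.norm_of_nonneg (integral_nonneg fun _ => norm_nonneg _)]
    simp_rw [heatKernelDigamma_eq, norm_mul, Complex.norm_real, Real.norm_eq_abs, Real.abs_exp]
    rw [integral_mul_const, integral_exp_neg_mul_Ioi_zero (by positivity),
      abs_of_pos (by positivity : 0 < 2 * c), mul_left_comm]
    gcongr
    exact hc.1.le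

lemma integral_prod_heatKernelDigamma {a b t : ℝ} (hab : a ≤ b) (ht : 0 < t) :
    ∫ y, heatKernelDigamma (t, y) ∂(volume.restrict (Ioc a b)).prod volume =
      ((t⁻¹ : ℝ) : ℂ) * ((Real.exp (-t * a ^ 2) - Real.exp (-t * b ^ 2) : ℝ) : ℂ) *
        ∫ l : ℝ, (Real.exp (-t * l ^ 2) : ℂ) * digamma (1 + Complex.I * l) := by
  unfold heatKernelDigamma
  rw [integral_prod_mul (fun c : ℝ => ((2 * c * Real.exp (-t * c ^ 2) : ℝ) : ℂ))
    (fun l : ℝ => (Real.exp (-t * l ^ 2) : ℂ) * digamma (1 + Complex.I * l)),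
    integral_complex_ofReal, ← intervalIntegral.integral_of_le hab,
    intervalIntegral_two_mul_mul_exp ht.ne', Complex.ofReal_mul]

lemma integral_integral_heatKernelDigamma {a b : ℝ} (ha : 0 < a) (hab : a ≤ b) :
    ∫ t in Ioi (0 : ℝ), ∫ y, heatKernelDigamma (t, y) ∂(volume.restrict (Ioc a b)).prod volume =
      2 * π * ((Real.log (Real.Gamma (1 + b)) : ℂ) - (Real.log (Real.Gamma (1 + a)) : ℂ)) := by
  have hint := integrable_heatKernelDigamma ha b
  have hswap := integral_integral_swap (f := fun t y => heatKernelDigamma (t, y)) hint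
  have hae : ∀ᵐ c ∂volume.restrict (Ioc a b), c ∉ range fun n : ℕ => (n : ℝ) + 1 :=
    ae_restrict_of_ae ((countable_range _).ae_notMem volume)
  rw [hswap, integral_prod _ hint.integral_prod_right,
    ← intervalIntegral_digamma_one_add ha (ha.trans_le hab),
    intervalIntegral.integral_of_le hab, ← integral_const_mul]
  refine integral_congr_ae ?_
  filter_upwards [hae, ae_restrict_mem measurableSet_Ioc] with c hcn hc
  have hc0 : 0 < c := ha.trans hc.1
  simp_rw [integral_heatKernelDigamma hc0]
  rw [integral_const_mul, integral_inv_sq_add_sq_mul_digamma hc0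
    fun n hn => hcn ⟨n, hn.symm⟩]
  have : (c : ℂ) ≠ 0 := by exact_mod_cast hc0.ne'
  push_cast
  field_simp

lemma integrableOn_and_integral_of_le {a b : ℝ} (ha : 0 < a) (hab : a ≤ b) :
    IntegrableOn
      (fun t : ℝ => ((t⁻¹ : ℝ) : ℂ) *
        ((Real.exp (-t * a ^ 2) - Real.exp (-t * b ^ 2) : ℝ) : ℂ) *
        ∫ l : ℝ, (Real.exp (-t * l ^ 2) : ℂ) * digamma (1 + Complex.I * l)) (Ioi 0) ∧
    ∫ t in Ioi (0 : ℝ),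
        ((t⁻¹ : ℝ) : ℂ) * ((Real.exp (-t * a ^ 2) - Real.exp (-t * b ^ 2) : ℝ) : ℂ) *
          ∫ l : ℝ, (Real.exp (-t * l ^ 2) : ℂ) * digamma (1 + Complex.I * l) =
      2 * π * ((Real.log (Real.Gamma (1 + b)) : ℂ) - (Real.log (Real.Gamma (1 + a)) : ℂ)) := by
  constructor
  · refine IntegrableOn.congr_fun (integrable_heatKernelDigamma ha b).integral_prod_left
      (fun t ht => ?_) measurableSet_Ioi
    exact integral_prod_heatKernelDigamma hab ht
  · rw [← integral_integral_heatKernelDigamma ha hab]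
    exact setIntegral_congr_fun measurableSet_Ioi fun t ht =>
      (integral_prod_heatKernelDigamma hab ht).symm

/-- Lemma `Gammacontr` (difference form): for `c₁, c₂ > 0`,
`(1/π) ∫₀^∞ t⁻¹ (e^{-tc₁²} - e^{-tc₂²}) ∫_ℝ e^{-tλ²} ψ(1+iλ) dλ dt
  = 2 log Γ(1+c₂) - 2 log Γ(1+c₁)`. -/
theorem stmt10 (c₁ c₂ : ℝ) (h₁ : 0 < c₁) (h₂ : 0 < c₂) :
    MeasureTheory.IntegrableOn
      (fun t : ℝ => ((t⁻¹ : ℝ) : ℂ) *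
        ((Real.exp (-t * c₁ ^ 2) - Real.exp (-t * c₂ ^ 2) : ℝ) : ℂ) *
        ∫ l : ℝ, (Real.exp (-t * l ^ 2) : ℂ) * digamma (1 + Complex.I * l))
      (Set.Ioi 0) ∧
    ((1 / Real.pi : ℝ) : ℂ) * (∫ t in Set.Ioi (0:ℝ),
        ((t⁻¹ : ℝ) : ℂ) * ((Real.exp (-t * c₁ ^ 2) - Real.exp (-t * c₂ ^ 2) : ℝ) : ℂ) *
          ∫ l : ℝ, (Real.exp (-t * l ^ 2) : ℂ) * digamma (1 + Complex.I * l)) =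
      2 * (Real.log (Real.Gamma (1 + c₂)) : ℂ) - 2 * (Real.log (Real.Gamma (1 + c₁)) : ℂ) := by
  have hπ : (π : ℂ) ≠ 0 := by exact_mod_cast Real.pi_ne_zero
  rcases le_total c₁ c₂ with h | h
  · obtain ⟨hi, he⟩ := integrableOn_and_integral_of_le h₁ h
    refine ⟨hi, ?_⟩
    rw [he]
    push_cast
    field_simp
  · obtain ⟨hi, he⟩ := integrableOn_and_integral_of_le h₂ h
    have e : (fun t : ℝ => ((t⁻¹ : ℝ) : ℂ) *
        ((Real.exp (-t * c₁ ^ 2) - Real.exp (-t * c₂ ^ 2) : ℝ) : ℂ) *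
        ∫ l : ℝ, (Real.exp (-t * l ^ 2) : ℂ) * digamma (1 + Complex.I * l)) =
      fun t : ℝ => -(((t⁻¹ : ℝ) : ℂ) *
        ((Real.exp (-t * c₂ ^ 2) - Real.exp (-t * c₁ ^ 2) : ℝ) : ℂ) *
        ∫ l : ℝ, (Real.exp (-t * l ^ 2) : ℂ) * digamma (1 + Complex.I * l)) := by
      funext t
      rw [← neg_sub (Real.exp (-t * c₂ ^ 2))]
      push_cast
      ring
    rw [e]
    refine ⟨hi.neg, ?_⟩
    rw [integral_neg, he]
    push_cast
    field_simp
    ring
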